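/- arXiv:1504.04256 — 8 statements merged into one kernel-verified Lean document; each statement's English description precedes it below -/
import Mathlib

section
/- Let U₁, U₂ ⊆ ℝⁿ be open sets with U₂ connected, let F : U₁ → ℝ, G : U₂ → ℝ and W : U₁ × U₂ → ℝ be smooth, and let σ : U₂ → U₁ be a smooth map such that for every y ∈ U₂ the point σ(y) is the unique global minimum on U₁ of the function x ↦ F(x) + W(x,y), and such that ∇G(y) = (∂W/∂y)(σ(y), y) for every y ∈ U₂. Then there is a constant C ∈ ℝ such that G(y) = min_{x ∈ U₁} (F(x) + W(x,y)) + C for all y ∈ U₂. -/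
/-- **Inversion formula for the generalized Legendre transform.**
Let `U₁, U₂ ⊆ ℝⁿ` be open with `U₂` connected, `F, G, W` smooth, and `σ : U₂ → U₁`
smooth such that `σ y` is the unique global minimum on `U₁` of `x ↦ F x + W x y`,
and `∇G(y) = ∂W/∂y (σ y, y)`.  Then there is a constant `C` with
`G y = min_{x ∈ U₁} (F x + W x y) + C` for all `y ∈ U₂`. -/
theorem stmt_0 {n : ℕ} (U₁ U₂ : Set (Fin n → ℝ)) (hU₁ : IsOpen U₁) (hU₂ : IsOpen U₂)
    (hU₂conn : IsConnected U₂)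
    (F : (Fin n → ℝ) → ℝ) (G : (Fin n → ℝ) → ℝ)
    (W : (Fin n → ℝ) → (Fin n → ℝ) → ℝ)
    (σ : (Fin n → ℝ) → (Fin n → ℝ))
    (hF : ContDiffOn ℝ (⊤ : ℕ∞) F U₁)
    (hG : ContDiffOn ℝ (⊤ : ℕ∞) G U₂)
    (hW : ContDiffOn ℝ (⊤ : ℕ∞) (fun p : (Fin n → ℝ) × (Fin n → ℝ) => W p.1 p.2) (U₁ ×ˢ U₂))
    (hσ : ContDiffOn ℝ (⊤ : ℕ∞) σ U₂)
    (hσmem : ∀ y ∈ U₂, σ y ∈ U₁)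
    (hmin : ∀ y ∈ U₂, ∀ x ∈ U₁, x ≠ σ y → F (σ y) + W (σ y) y < F x + W x y)
    (hgrad : ∀ y ∈ U₂, fderiv ℝ G y = fderiv ℝ (fun y' => W (σ y) y') y) :
    ∃ C : ℝ, ∀ y ∈ U₂, G y = (F (σ y) + W (σ y) y) + C := by
  have hWd : ∀ y ∈ U₂, ∀ x ∈ U₁,
      DifferentiableAt ℝ (fun p : (Fin n → ℝ) × (Fin n → ℝ) => W p.1 p.2) (x, y) :=
    fun y hy x hx => (hW.contDiffAt ((hU₁.prod hU₂).mem_nhds ⟨hx, hy⟩)).differentiableAt (by simp)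
  have hM : ∀ y ∈ U₂, DifferentiableAt ℝ (fun y' => F (σ y') + W (σ y') y') y := by
    intro y hy
    have hσy : DifferentiableAt ℝ σ y :=
      (hσ.contDiffAt (hU₂.mem_nhds hy)).differentiableAt (by simp)
    have hFy : DifferentiableAt ℝ F (σ y) :=
      (hF.contDiffAt (hU₁.mem_nhds (hσmem y hy))).differentiableAt (by simp)
    exact (hFy.comp y hσy).add
      ((hWd y hy _ (hσmem y hy)).comp (f := fun y' => (σ y', y')) y (hσy.prodMk differentiableAt_fun_id))
  have hWp : ∀ y ∈ U₂, DifferentiableAt ℝ (fun y' => W (σ y) y') y := fun y hy =>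
    (hWd y hy _ (hσmem y hy)).comp y
      ((differentiableAt_const (σ y)).prodMk differentiableAt_fun_id)
  have hMgrad : ∀ y ∈ U₂, fderiv ℝ (fun y' => F (σ y') + W (σ y') y') y =
      fderiv ℝ (fun y' => W (σ y) y') y := by
    intro y hy
    have hmax : IsLocalMax (fun y' => F (σ y') + W (σ y') y' - W (σ y) y') y := by
      filter_upwards [hU₂.mem_nhds hy] with z hz
      rcases eq_or_ne (σ y) (σ z) with h | h
      · simp [h]
      · linarith [hmin z hz (σ y) (hσmem y hy) h]
    have h := hmax.fderiv_eq_zero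
    rw [fderiv_fun_sub (hM y hy) (hWp y hy)] at h
    exact sub_eq_zero.mp h
  obtain ⟨C, hC⟩ := hU₂.exists_eq_add_of_fderiv_eq (𝕜 := ℝ) hU₂conn.isPreconnected
    (hG.differentiableOn (by simp)) (fun y hy => (hM y hy).differentiableWithinAt)
    (fun y hy => (hgrad y hy).trans (hMgrad y hy).symm)
  exact ⟨C, fun y hy => hC hy⟩
end

section
/- Let f : ℝⁿ → ℝⁿ be a quadratic map and let U ⊆ ℝⁿ be a convex open set such that the derivative Df(x) : ℝⁿ → ℝⁿ is invertible for every x ∈ U. Then f is injective on U and f(U) is open; hence f restricts to a diffeomorphism of U onto an open subset of ℝⁿ. -/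
/-- The strict derivative of `x ↦ Q x x + L x + c` at `x` is `v ↦ Q x v + Q v x + L v`. -/
theorem hasStrictFDerivAt_quadratic {E F : Type*} [NormedAddCommGroup E] [NormedSpace ℝ E]
    [FiniteDimensional ℝ E] [NormedAddCommGroup F] [NormedSpace ℝ F]
    (Q : E →ₗ[ℝ] E →ₗ[ℝ] F) (L : E →ₗ[ℝ] F) (c : F) (x : E) :
    HasStrictFDerivAt (fun x => Q x x + L x + c)
      (LinearMap.toContinuousLinearMap (Q x + Q.flip x + L)) x := by
  let B : E →L[ℝ] E →L[ℝ] F :=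
    LinearMap.toContinuousLinearMap (LinearMap.toContinuousLinearMap.toLinearMap ∘ₗ Q)
  have h := ((B.hasStrictFDerivAt (x := x)).clm_apply (hasStrictFDerivAt_id x)).add
    (LinearMap.toContinuousLinearMap L).hasStrictFDerivAt |>.add_const c
  convert h using 1 <;> rfl

/-- The midpoint identity: the mean value theorem for a quadratic map is exact, with the
derivative evaluated at the midpoint. -/
theorem quadratic_sub_eq_midpoint {E F : Type*} [AddCommGroup E] [Module ℝ E]
    [AddCommGroup F] [Module ℝ F]
    (Q : E →ₗ[ℝ] E →ₗ[ℝ] F) (L : E →ₗ[ℝ] F) (c : F) (x y : E) :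
    (Q x x + L x + c) - (Q y y + L y + c) =
      (Q (midpoint ℝ x y) + Q.flip (midpoint ℝ x y) + L) (x - y) := by
  simp only [midpoint_eq_smul_add, LinearMap.add_apply, LinearMap.flip_apply, map_smul, map_add,
    map_sub, LinearMap.smul_apply, invOf_eq_inv]
  module


/-- Let `f : ℝⁿ → ℝⁿ` be a quadratic map (`f x = Q x x + L x + c` with `Q` symmetric
bilinear, `L` linear) and `U` a convex open set on which the derivative `Df(x)` is
everywhere invertible.  Then `f` is injective on `U` and `f(U)` is open; hence `f`
restricts to a diffeomorphism of `U` onto an open subset of `ℝⁿ`. -/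
theorem stmt_3 {n : ℕ}
    (Q : (Fin n → ℝ) →ₗ[ℝ] (Fin n → ℝ) →ₗ[ℝ] (Fin n → ℝ))
    (hQsymm : ∀ v w, Q v w = Q w v)
    (L : (Fin n → ℝ) →ₗ[ℝ] (Fin n → ℝ)) (c : Fin n → ℝ)
    (f : (Fin n → ℝ) → (Fin n → ℝ))
    (hf : ∀ x, f x = Q x x + L x + c)
    (U : Set (Fin n → ℝ)) (hUopen : IsOpen U) (hUconv : Convex ℝ U)
    (hDf : ∀ x ∈ U, Function.Bijective (fderiv ℝ f x)) :
    Set.InjOn f U ∧ IsOpen (f '' U) := by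
  obtain rfl : f = fun x => Q x x + L x + c := funext hf
  have hD := hasStrictFDerivAt_quadratic Q L c
  simp only [fun x => (hD x).hasFDerivAt.fderiv] at hDf
  refine ⟨fun x hx y hy hxy => ?_, isOpen_iff_mem_nhds.2 ?_⟩
  · have h := quadratic_sub_eq_midpoint Q L c x y
    rw [sub_eq_zero.2 hxy] at h
    exact sub_eq_zero.1 ((hDf _ (hUconv.midpoint_mem hx hy)).1 (h.symm.trans (map_zero _).symm))
  · rintro _ ⟨x, hx, rfl⟩
    rw [← (hD x).map_nhds_eq_of_surj (LinearMap.range_eq_top.2 (hDf x hx).2)]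
    exact Filter.image_mem_map (hUopen.mem_nhds hx)
end

section
/- For every x ∈ ℛ and every α ∈ ℝⁿ with all αᵢ > 0, the n × n mixed Hessian matrix [∂²W/∂xᵢ∂αⱼ(α,x)]_{1 ≤ i,j ≤ n} is non-singular. -/
/-- The kinetic term `W(α,x)` of the canonical metric on `ℂℙⁿ`, as a function on the
open standard simplex: `W(α,x) = (1/2)(Σᵢ αᵢ²/xᵢ + (Σᵢ αᵢ)²/(1 − Σᵢ xᵢ))`. -/
noncomputable def Wcp (n : ℕ) (α x : Fin n → ℝ) : ℝ :=
  (1 / 2) * ((∑ i, (α i) ^ 2 / x i) + (∑ i, α i) ^ 2 / (1 - ∑ i, x i))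

/-- The interior of the moment polytope of `ℂℙⁿ`: the open standard simplex. -/
def Pcp (n : ℕ) : Set (Fin n → ℝ) := {x | (∀ i, 0 < x i) ∧ ∑ i, x i < 1}

/-- The subregion `ℛ = {x ∈ 𝒫 : Σᵢ xᵢ > 1/2}`. -/
def Rcp (n : ℕ) : Set (Fin n → ℝ) := {x ∈ Pcp n | 1 / 2 < ∑ i, x i}

/-- The mixed Hessian matrix `[∂²W/∂xᵢ∂αⱼ(α,x)]` of `Wcp`. -/
noncomputable def Hcp (n : ℕ) (α x : Fin n → ℝ) : Matrix (Fin n) (Fin n) ℝ :=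
  Matrix.of fun i j =>
    fderiv ℝ (fun x' => fderiv ℝ (fun a => Wcp n a x') α (Pi.single j 1)) x (Pi.single i 1)

/-- The partial derivatives of `Wcp` in the first variable. -/
theorem fderiv_Wcp_single {n : ℕ} (α x : Fin n → ℝ) (j : Fin n) :
    fderiv ℝ (fun a => Wcp n a x) α (Pi.single j 1) =
      α j * (x j)⁻¹ + (∑ i, α i) * (1 - ∑ i, x i)⁻¹ := by
  have hp : ∀ i, HasFDerivAt (fun a : Fin n → ℝ => a i)
      (ContinuousLinearMap.proj (R := ℝ) (φ := fun _ : Fin n => ℝ) i) α :=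
    fun i => hasFDerivAt_apply i α
  have h₁ := HasFDerivAt.fun_sum (u := Finset.univ)
    fun i _ => ((hp i).pow 2).mul_const (x i)⁻¹
  have h₂ := ((HasFDerivAt.fun_sum (u := Finset.univ) fun i _ => hp i).pow 2).mul_const
    (1 - ∑ i, x i)⁻¹
  have h : HasFDerivAt (fun a => Wcp n a x) _ α := (h₁.add h₂).const_mul (1 / 2)
  rw [h.fderiv]
  simp [Pi.single_apply]
  ring

/-- The mixed Hessian of `Wcp` is a rank one perturbation of a diagonal matrix. -/
theorem Hcp_apply {n : ℕ} (α : Fin n → ℝ) {x : Fin n → ℝ} (hx : x ∈ Pcp n) (i j : Fin n) :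
    Hcp n α x i j =
      (if i = j then -(α j / x j ^ 2) else 0) + (∑ k, α k) / (1 - ∑ k, x k) ^ 2 := by
  have hp : ∀ k, HasFDerivAt (fun y : Fin n → ℝ => y k)
      (ContinuousLinearMap.proj (R := ℝ) (φ := fun _ : Fin n => ℝ) k) x :=
    fun k => hasFDerivAt_apply k x
  have h₁ := ((hasDerivAt_inv (hx.1 j).ne').comp_hasFDerivAt x (hp j)).const_mul (α j)
  have hs := (HasFDerivAt.fun_sum (u := Finset.univ) fun k _ => hp k).const_sub 1
  have h₂ := ((hasDerivAt_inv (sub_pos.2 hx.2).ne').comp_hasFDerivAt x hs).const_mul (∑ k, α k)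
  have h : HasFDerivAt
      (fun y : Fin n → ℝ => α j * (y j)⁻¹ + (∑ k, α k) * (1 - ∑ k, y k)⁻¹) _ x := h₁.add h₂
  simp only [Hcp, Matrix.of_apply, fderiv_Wcp_single]
  rw [h.fderiv]
  by_cases hij : i = j
  · subst hij
    simp [Pi.single_apply, div_eq_mul_inv]
  · simp [Pi.single_apply, div_eq_mul_inv, hij, Ne.symm hij]

/-- For every `x ∈ ℛ` and every `α` with all `αᵢ > 0`, the mixed Hessian
`[∂²W/∂xᵢ∂αⱼ(α,x)]` of the `ℂℙⁿ` kinetic term is non-singular. -/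
theorem stmt_7 {n : ℕ} (hn : 0 < n) (x : Fin n → ℝ) (hx : x ∈ Rcp n)
    (α : Fin n → ℝ) (hα : ∀ i, 0 < α i) :
    (Hcp n α x).det ≠ 0 := by
  obtain ⟨hP, hs⟩ := hx
  have : Nonempty (Fin n) := ⟨⟨0, hn⟩⟩
  have hA : 0 < ∑ k, α k := Finset.sum_pos (fun i _ => hα i) Finset.univ_nonempty
  have hd : 0 < 1 - ∑ k, x k := sub_pos.2 hP.2
  have hcs : (∑ k, x k) ^ 2 / ∑ k, α k ≤ ∑ k, x k ^ 2 / α k :=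
    Finset.sq_sum_div_le_sum_sq_div _ _ fun i _ => hα i
  set c := (∑ k, α k) / (1 - ∑ k, x k) ^ 2 with hc
  have hcT : 1 < c * ∑ k, x k ^ 2 / α k := by
    rw [div_le_iff₀ hA] at hcs
    rw [hc, div_mul_eq_mul_div, one_lt_div (by positivity)]
    nlinarith
  intro hdet
  obtain ⟨v, hv, hHv⟩ := Matrix.exists_mulVec_eq_zero_iff.2 hdet
  have hvi : ∀ i, v i = c * (∑ k, v k) * (x i ^ 2 / α i) := by
    intro i
    have h := congrFun hHv i
    simp only [Matrix.mulVec, dotProduct, Hcp_apply α hP, add_mul, Finset.sum_add_distrib,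
      ite_mul, zero_mul, Finset.sum_ite_eq, Finset.mem_univ, if_true, Pi.zero_apply,
      ← Finset.mul_sum, ← hc] at h
    have hxi := (hP.1 i).ne'
    have hαi := (hα i).ne'
    have h' : c * ∑ k, v k = α i / x i ^ 2 * v i := by linarith
    rw [h']
    field_simp
  have hV : ∑ k, v k = c * (∑ k, v k) * ∑ k, x k ^ 2 / α k := by
    rw [Finset.mul_sum]
    exact Finset.sum_congr rfl fun i _ => hvi i
  have hV₀ : ∑ k, v k = 0 := by
    have h : (∑ k, v k) * (c * (∑ k, x k ^ 2 / α k) - 1) = 0 := by linear_combination -hV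
    exact (mul_eq_zero.1 h).resolve_right (sub_pos.2 hcT).ne'
  exact hv (funext fun i => by simp [hvi i, hV₀])
end

section
/- For every x ∈ 𝒫 and every α ∈ ℝⁿ with all αᵢ > 0, the determinant of the mixed Hessian matrix [∂²W/∂xᵢ∂αⱼ(α,x)] equals ((−1)ⁿ α₁⋯αₙ (Σᵢ αᵢ))/(x₁²⋯xₙ² (1 − Σᵢ xᵢ)²) · [ (1 − Σᵢ xᵢ)²/(Σᵢ αᵢ) − Σᵢ xᵢ²/αᵢ ]. -/
theorem fderiv_Wcp_apply_single {n : ℕ} (α x : Fin n → ℝ) (j : Fin n) :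
    fderiv ℝ (fun a => Wcp n a x) α (Pi.single j 1)
      = α j / x j + (∑ i, α i) / (1 - ∑ i, x i) := by
  have hp (i : Fin n) : HasFDerivAt (fun a : Fin n → ℝ => a i)
      (ContinuousLinearMap.proj (R := ℝ) i) α := hasFDerivAt_apply i α
  have h := (((HasFDerivAt.fun_sum (u := Finset.univ)
      fun i _ => ((hp i).pow 2).mul_const (x i)⁻¹).add
    (((HasFDerivAt.fun_sum (u := Finset.univ) fun i _ => hp i).pow 2).mul_const
      (1 - ∑ i, x i)⁻¹)).const_mul (1 / 2 : ℝ))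
  have he : (fun a => Wcp n a x) = fun a : Fin n → ℝ => (1 / 2 : ℝ) *
      ((∑ i, (a i) ^ 2 * (x i)⁻¹) + (∑ i, a i) ^ 2 * (1 - ∑ i, x i)⁻¹) := by
    funext a
    simp only [Wcp, div_eq_mul_inv]
  rw [he]
  refine (congrArg (fun L => L (Pi.single j 1)) h.fderiv).trans ?_
  simp [Pi.single_apply, div_eq_mul_inv]
  ring

theorem Hcp_eq {n : ℕ} {α x : Fin n → ℝ} (hx : ∀ i, x i ≠ 0) (hs : 1 - ∑ i, x i ≠ 0) :
    Hcp n α x = Matrix.diagonal (fun i => -(α i / x i ^ 2))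
      + Matrix.replicateCol Unit (fun _ => (∑ i, α i) / (1 - ∑ i, x i) ^ 2)
        * Matrix.replicateRow Unit (fun _ => (1 : ℝ)) := by
  ext i j
  have hp (i : Fin n) : HasFDerivAt (fun a : Fin n → ℝ => a i)
      (ContinuousLinearMap.proj (R := ℝ) i) x := hasFDerivAt_apply i x
  have hj := ((hasDerivAt_inv (hx j)).comp_hasFDerivAt x (hp j)).const_mul (α j)
  have hS := ((hasDerivAt_inv hs).comp_hasFDerivAt x
    ((HasFDerivAt.fun_sum (u := Finset.univ) fun i _ => hp i).const_sub 1)).const_mul (∑ i, α i)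
  have h := hj.add hS
  simp only [Hcp, Matrix.of_apply, fderiv_Wcp_apply_single]
  refine (congrArg (fun L => L (Pi.single i 1)) h.fderiv).trans ?_
  rcases eq_or_ne i j with rfl | hij
  · simp [Matrix.mul_apply, Pi.single_apply, div_eq_mul_inv]
  · simp [Matrix.mul_apply, Pi.single_apply, div_eq_mul_inv, hij, hij.symm]

theorem det_diagonal_add_replicateCol_mul_replicateRow {n : ℕ} {d : Fin n → ℝ}
    (hd : ∀ i, d i ≠ 0) (u v : Fin n → ℝ) :
    (Matrix.diagonal d + Matrix.replicateCol Unit u * Matrix.replicateRow Unit v).det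
      = (∏ i, d i) * (1 + ∑ i, u i * v i / d i) := by
  have h : Matrix.diagonal d + Matrix.replicateCol Unit u * Matrix.replicateRow Unit v
      = Matrix.diagonal d * (1 + Matrix.replicateCol Unit (fun i => u i / d i)
        * Matrix.replicateRow Unit v) := by
    rw [mul_add, mul_one]
    congr 1
    ext i j
    rw [Matrix.diagonal_mul]
    simp only [Matrix.mul_apply, Matrix.replicateCol_apply, Matrix.replicateRow_apply,
      Finset.univ_unique, Finset.sum_singleton]
    rw [← mul_assoc, mul_div_cancel₀ _ (hd i)]
  rw [h, Matrix.det_mul, Matrix.det_diagonal, Matrix.det_one_add_replicateCol_mul_replicateRow]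
  simp only [dotProduct]
  congr 2
  exact Finset.sum_congr rfl fun i _ => by ring

/-- Explicit determinant of the mixed Hessian of the `ℂℙⁿ` kinetic term: for `x ∈ 𝒫`
and `α` with all `αᵢ > 0`,
`det [∂²W/∂xᵢ∂αⱼ] = ((−1)ⁿ α₁⋯αₙ (Σαᵢ))/(x₁²⋯xₙ²(1−Σxᵢ)²) · [(1−Σxᵢ)²/(Σαᵢ) − Σ xᵢ²/αᵢ]`. -/
theorem stmt_8 {n : ℕ} (hn : 0 < n) (x : Fin n → ℝ) (hx : x ∈ Pcp n)
    (α : Fin n → ℝ) (hα : ∀ i, 0 < α i) :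
    (Hcp n α x).det
      = ((-1 : ℝ) ^ n * (∏ i, α i) * (∑ i, α i))
          / ((∏ i, (x i) ^ 2) * (1 - ∑ i, x i) ^ 2)
        * ((1 - ∑ i, x i) ^ 2 / (∑ i, α i) - ∑ i, (x i) ^ 2 / α i) := by
  obtain ⟨hx0, hx1⟩ := hx
  have hs : 1 - ∑ i, x i ≠ 0 := (sub_pos.2 hx1).ne'
  have : Nonempty (Fin n) := ⟨⟨0, hn⟩⟩
  have hA : ∑ i, α i ≠ 0 := (Finset.sum_pos (fun i _ => hα i) Finset.univ_nonempty).ne'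
  have hP : ∏ i, x i ^ 2 ≠ 0 := Finset.prod_ne_zero_iff.2 fun i _ => pow_ne_zero 2 (hx0 i).ne'
  rw [Hcp_eq (fun i => (hx0 i).ne') hs, det_diagonal_add_replicateCol_mul_replicateRow
    fun i => neg_ne_zero.2 (div_pos (hα i) (pow_pos (hx0 i) 2)).ne']
  have hsum : ∑ i, (∑ i, α i) / (1 - ∑ i, x i) ^ 2 * 1 / -(α i / x i ^ 2)
      = -((∑ i, α i) / (1 - ∑ i, x i) ^ 2 * ∑ i, x i ^ 2 / α i) := by
    rw [Finset.mul_sum, ← Finset.sum_neg_distrib]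
    refine Finset.sum_congr rfl fun i _ => ?_
    rw [mul_one, div_neg, div_div_eq_mul_div, mul_div_assoc]
  rw [hsum, Finset.prod_neg, Finset.card_fin, Finset.prod_div_distrib]
  field_simp
  ring
end

section
/- Let V be a real-valued function that is C¹ on an open neighborhood of the closure of 𝒫, strictly convex on 𝒫, and satisfies ∂V/∂xᵢ(x) < 0 for all i = 1,…,n at every x ∈ 𝒫 with x₁+⋯+xₙ = 1/2. Then for every α ∈ ℝⁿ with all αᵢ > 0, the function x ↦ V(x) + W(α,x) attains a unique global minimum on 𝒫, and the minimizer lies in ℛ. -/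
theorem convex_Pcp (n : ℕ) : Convex ℝ (Pcp n) := by
  rintro x ⟨hx, hxs⟩ y ⟨hy, hys⟩ a b ha hb hab
  refine ⟨fun i => convex_Ioi (0 : ℝ) (hx i) (hy i) ha hb hab, ?_⟩
  have := convex_Iio (1 : ℝ) hxs hys ha hb hab
  simpa [Finset.sum_add_distrib, Finset.mul_sum] using this

theorem isOpen_Pcp (n : ℕ) : IsOpen (Pcp n) := by
  have h : Pcp n = (⋂ i, {x | 0 < x i}) ∩ {x | ∑ i, x i < 1} := by
    ext x; simp [Pcp]
  rw [h]
  refine (isOpen_iInter_of_finite fun i => isOpen_lt (by fun_prop) (by fun_prop)).inter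
    (isOpen_lt (by fun_prop) (by fun_prop))

theorem Pcp_subset_Icc (n : ℕ) : Pcp n ⊆ Set.Icc 0 1 := by
  rintro x ⟨hx, hxs⟩
  refine ⟨fun i => (hx i).le, fun i => ?_⟩
  have := Finset.single_le_sum (f := x) (fun j _ => (hx j).le) (Finset.mem_univ i)
  exact this.trans hxs.le

theorem isCompact_closure_Pcp (n : ℕ) : IsCompact (closure (Pcp n)) :=
  isCompact_Icc.closure_of_subset (Pcp_subset_Icc n)

theorem div_convex_combination_le {c x y a b : ℝ} (hc : 0 ≤ c) (hx : 0 < x) (hy : 0 < y)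
    (ha : 0 ≤ a) (hb : 0 ≤ b) (hab : a + b = 1) :
    c / (a * x + b * y) ≤ a * (c / x) + b * (c / y) := by
  have h := (convexOn_zpow (𝕜 := ℝ) (-1)).2 hx hy ha hb hab
  simp only [zpow_neg_one, smul_eq_mul] at h
  calc c / (a * x + b * y) = c * (a * x + b * y)⁻¹ := div_eq_mul_inv _ _
    _ ≤ c * (a * x⁻¹ + b * y⁻¹) := mul_le_mul_of_nonneg_left h hc
    _ = _ := by ring

theorem convexOn_Wcp (n : ℕ) (α : Fin n → ℝ) : ConvexOn ℝ (Pcp n) (Wcp n α) := by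
  refine ⟨convex_Pcp n, ?_⟩
  rintro x ⟨hx, hxs⟩ y ⟨hy, hys⟩ a b ha hb hab
  have h1 : ∑ i, α i ^ 2 / (a * x i + b * y i) ≤
      a * ∑ i, α i ^ 2 / x i + b * ∑ i, α i ^ 2 / y i := by
    rw [Finset.mul_sum, Finset.mul_sum, ← Finset.sum_add_distrib]
    exact Finset.sum_le_sum fun i _ =>
      div_convex_combination_le (sq_nonneg _) (hx i) (hy i) ha hb hab
  have h2 := div_convex_combination_le (sq_nonneg (∑ i, α i)) (sub_pos.2 hxs) (sub_pos.2 hys)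
    ha hb hab
  have h3 : a * (1 - ∑ i, x i) + b * (1 - ∑ i, y i) = 1 - ∑ i, (a * x i + b * y i) := by
    rw [Finset.sum_add_distrib, ← Finset.mul_sum, ← Finset.mul_sum]
    linear_combination hab
  rw [h3] at h2
  simp only [Wcp, Pi.add_apply, Pi.smul_apply, smul_eq_mul]
  linarith

theorem continuousOn_Wcp (n : ℕ) (α : Fin n → ℝ) : ContinuousOn (Wcp n α) (Pcp n) := by
  unfold Wcp
  refine continuousOn_const.mul (.add ?_ ?_)
  · exact continuousOn_finsetSum _ fun i _ =>
      continuousOn_const.div (by fun_prop) fun x hx => (hx.1 i).ne'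
  · exact continuousOn_const.div (by fun_prop) fun x hx => (sub_pos.2 hx.2).ne'

/-- `W` blows up at the boundary of the simplex, so `V + W` attains its minimum for every `V`
that is continuous up to the boundary. -/
theorem exists_isMinOn_add_Wcp {n : ℕ} (hn : 0 < n) {V : (Fin n → ℝ) → ℝ}
    (hV : ContinuousOn V (closure (Pcp n))) {α : Fin n → ℝ} (hα : ∀ i, 0 < α i) :
    ∃ x₀ ∈ Pcp n, IsMinOn (fun x => V x + Wcp n α x) (Pcp n) x₀ := by
  have : Nonempty (Fin n) := ⟨⟨0, hn⟩⟩
  have hA : 0 < ∑ i, α i := Finset.sum_pos (fun i _ => hα i) Finset.univ_nonempty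
  obtain ⟨m, hm⟩ := (isCompact_closure_Pcp n).bddBelow_image hV
  replace hm : ∀ x ∈ Pcp n, m ≤ V x := fun x hx => hm ⟨x, subset_closure hx, rfl⟩
  obtain ⟨p, hp⟩ : (Pcp n).Nonempty := by
    refine ⟨fun _ => 1 / (n + 1), fun _ => by positivity, ?_⟩
    have : (0 : ℝ) < n + 1 := by positivity
    simp only [Finset.sum_const, Finset.card_univ, Fintype.card_fin, nsmul_eq_mul]
    rw [mul_one_div, div_lt_one this]
    linarith
  have hterm : ∀ x ∈ Pcp n, (∀ i, 0 < α i ^ 2 / x i) ∧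
      0 < (∑ i, α i) ^ 2 / (1 - ∑ i, x i) := fun x hx =>
    ⟨fun i => div_pos (pow_pos (hα i) 2) (hx.1 i), div_pos (pow_pos hA 2) (sub_pos.2 hx.2)⟩
  have hsum : ∀ x ∈ Pcp n, 0 ≤ ∑ i, α i ^ 2 / x i := fun x hx =>
    Finset.sum_nonneg fun i _ => ((hterm x hx).1 i).le
  set C := V p + Wcp n α p - m with hC
  have hWp : 0 < Wcp n α p := by
    have := (hterm p hp).2
    have := hsum p hp
    unfold Wcp; linarith
  have hCpos : 0 < C := by linarith [hm p hp]
  set K : Set (Fin n → ℝ) :=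
    {x | (∀ i, α i ^ 2 ≤ 2 * C * x i) ∧ (∑ i, α i) ^ 2 ≤ 2 * C * (1 - ∑ i, x i)} with hK
  have hKP : K ⊆ Pcp n := fun x hx =>
    ⟨fun i => pos_of_mul_pos_right ((pow_pos (hα i) 2).trans_le (hx.1 i)) (by positivity),
      sub_pos.1 (pos_of_mul_pos_right ((pow_pos hA 2).trans_le hx.2) (by positivity))⟩
  have hPK : ∀ x ∈ Pcp n, Wcp n α x ≤ C → x ∈ K := by
    intro x hx hW
    unfold Wcp at hW
    refine ⟨fun i => ?_, ?_⟩
    · rw [← div_le_iff₀ (hx.1 i)]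
      have := Finset.single_le_sum (f := fun i => α i ^ 2 / x i)
        (fun j _ => ((hterm x hx).1 j).le) (Finset.mem_univ i)
      have := (hterm x hx).2
      linarith
    · rw [← div_le_iff₀ (sub_pos.2 hx.2)]
      have := hsum x hx
      linarith
  have hKclosed : IsClosed K := by
    have h : K = (⋂ i, {x | α i ^ 2 ≤ 2 * C * x i}) ∩
        {x | (∑ i, α i) ^ 2 ≤ 2 * C * (1 - ∑ i, x i)} := by
      ext x; simp [hK]
    rw [h]
    exact (isClosed_iInter fun i => isClosed_le (by fun_prop) (by fun_prop)).inter
      (isClosed_le (by fun_prop) (by fun_prop))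
  have hKcompact : IsCompact K :=
    isCompact_Icc.of_isClosed_subset hKclosed (hKP.trans (Pcp_subset_Icc n))
  have hpK : p ∈ K := hPK p hp (by linarith [hm p hp])
  obtain ⟨x₀, hx₀, hmin⟩ := hKcompact.exists_isMinOn ⟨p, hpK⟩
    ((hV.mono (hKP.trans subset_closure)).add ((continuousOn_Wcp n α).mono hKP))
  refine ⟨x₀, hKP hx₀, fun x hx => ?_⟩
  by_cases hxC : Wcp n α x ≤ C
  · exact hmin (hPK x hx hxC)
  · have h1 : V x₀ + Wcp n α x₀ ≤ V p + Wcp n α p := hmin hpK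
    have h2 := hm x hx
    show V x₀ + Wcp n α x₀ ≤ V x + Wcp n α x
    linarith

theorem hasDerivAt_Wcp_add_single {n : ℕ} (α : Fin n → ℝ) {x : Fin n → ℝ} (hx : x ∈ Pcp n)
    (i : Fin n) :
    HasDerivAt (fun t : ℝ => Wcp n α (x + t • Pi.single i 1))
      ((1 / 2) * ((∑ j, α j) ^ 2 / (1 - ∑ j, x j) ^ 2 - α i ^ 2 / x i ^ 2)) 0 := by
  have hcoord : ∀ j, HasDerivAt (fun t : ℝ => x j + t * (Pi.single i 1 : Fin n → ℝ) j)
      ((Pi.single i 1 : Fin n → ℝ) j) 0 := fun j => by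
    simpa using ((hasDerivAt_id (0 : ℝ)).mul_const ((Pi.single i 1 : Fin n → ℝ) j)).const_add (x j)
  have hs : HasDerivAt (fun t : ℝ => ∑ j, (x j + t * (Pi.single i 1 : Fin n → ℝ) j)) 1 0 := by
    simpa using HasDerivAt.fun_sum (u := Finset.univ) fun j _ => hcoord j
  have h1 := HasDerivAt.fun_sum (u := Finset.univ) fun j _ =>
    (hasDerivAt_const (0 : ℝ) (α j ^ 2)).div (hcoord j) (by simpa using (hx.1 j).ne')
  have h2 := (hasDerivAt_const (0 : ℝ) ((∑ j, α j) ^ 2)).div (hs.const_sub 1)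
    (by simpa using (sub_pos.2 hx.2).ne')
  refine ((h1.add h2).const_mul (1 / 2)).congr_deriv ?_
  have h3 : ∀ j, (0 * (x j + 0 * (Pi.single i 1 : Fin n → ℝ) j) -
      α j ^ 2 * (Pi.single i 1 : Fin n → ℝ) j) / (x j + 0 * (Pi.single i 1 : Fin n → ℝ) j) ^ 2 =
      if j = i then -(α j ^ 2 / x j ^ 2) else 0 := by
    intro j
    split_ifs with h
    · subst h; simp [neg_div]
    · simp [h]
  simp only [h3]
  simp
  ring

/-- Monotonicity of the directional derivative of a convex function along a segment. -/
theorem fderiv_apply_le_of_convexOn {E : Type*} [NormedAddCommGroup E] [NormedSpace ℝ E]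
    {s : Set E} {f : E → ℝ} (hf : ConvexOn ℝ s f) {x v : E} {T : ℝ} (hT : 0 ≤ T) (hx : x ∈ s)
    (hy : x + T • v ∈ s) (hfx : DifferentiableAt ℝ f x) (hfy : DifferentiableAt ℝ f (x + T • v)) :
    fderiv ℝ f x v ≤ fderiv ℝ f (x + T • v) v := by
  rcases hT.eq_or_lt with rfl | hT
  · simp
  have hline : ∀ t : ℝ, AffineMap.lineMap x (x + v) t = x + t • v := fun t => by
    simp [AffineMap.lineMap_apply, add_comm]
  have hconv : ConvexOn ℝ ((fun t : ℝ => x + t • v) ⁻¹' s) (fun t : ℝ => f (x + t • v)) := by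
    have := hf.comp_affineMap (AffineMap.lineMap x (x + v) : ℝ →ᵃ[ℝ] E)
    simpa [Function.comp_def, Set.preimage, hline] using this
  have hd : ∀ t : ℝ, HasDerivAt (fun t : ℝ => x + t • v) v t := fun t => by
    simpa using ((hasDerivAt_id t).smul_const v).const_add x
  have h0 : HasDerivAt (fun t : ℝ => f (x + t • v)) (fderiv ℝ f x v) 0 :=
    HasFDerivAt.comp_hasDerivAt (f := fun t : ℝ => x + t • v) 0
      (by simpa using hfx.hasFDerivAt) (hd 0)
  have h1 : HasDerivAt (fun t : ℝ => f (x + t • v)) (fderiv ℝ f (x + T • v) v) T :=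
    HasFDerivAt.comp_hasDerivAt (f := fun t : ℝ => x + t • v) T hfy.hasFDerivAt (hd T)
  exact (hconv.le_slope_of_hasDerivAt (by simpa using hx) hy hT h0).trans
    (hconv.slope_le_of_hasDerivAt (by simpa using hx) hy hT h1)

theorem exists_mul_sum_le_mul_sum {ι : Type*} {s : Finset ι} (hs : s.Nonempty) (a b : ι → ℝ) :
    ∃ i ∈ s, (∑ j ∈ s, a j) * b i ≤ a i * ∑ j ∈ s, b j := by
  refine Finset.exists_le_of_sum_le hs (le_of_eq ?_)
  rw [← Finset.mul_sum, ← Finset.sum_mul]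

/-- Let `V` be `C¹` on an open neighborhood of the closure of `𝒫`, strictly convex
on `𝒫`, with `∂V/∂xᵢ < 0` (all `i`) at every point of `𝒫` on the hyperplane
`Σ xᵢ = 1/2`.  Then for every `α` with all `αᵢ > 0` the function
`x ↦ V(x) + W(α,x)` attains a unique global minimum on `𝒫`, and the minimizer lies
in `ℛ`. -/
theorem stmt_13 {n : ℕ} (hn : 0 < n) (V : (Fin n → ℝ) → ℝ)
    (hV : ∃ O : Set (Fin n → ℝ), IsOpen O ∧ closure (Pcp n) ⊆ O ∧ ContDiffOn ℝ 1 V O)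
    (hVconv : StrictConvexOn ℝ (Pcp n) V)
    (hVgrad : ∀ x ∈ Pcp n, ∑ i, x i = 1 / 2 →
      ∀ i, fderiv ℝ V x (Pi.single i 1) < 0)
    (α : Fin n → ℝ) (hα : ∀ i, 0 < α i) :
    ∃ x₀ ∈ Rcp n, (∀ x ∈ Pcp n, V x₀ + Wcp n α x₀ ≤ V x + Wcp n α x) ∧
      ∀ x ∈ Pcp n, (∀ y ∈ Pcp n, V x + Wcp n α x ≤ V y + Wcp n α y) → x = x₀ := by
  have : Nonempty (Fin n) := ⟨⟨0, hn⟩⟩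
  obtain ⟨O, hO, hPO, hVO⟩ := hV
  have hdiff : ∀ x ∈ Pcp n, DifferentiableAt ℝ V x := fun x hx =>
    (hVO.contDiffAt (hO.mem_nhds (hPO (subset_closure hx)))).differentiableAt one_ne_zero
  obtain ⟨x₀, hx₀, hmin⟩ := exists_isMinOn_add_Wcp hn (hVO.continuousOn.mono hPO) hα
  refine ⟨x₀, ⟨hx₀, ?_⟩, fun x hx => hmin hx, fun x hx hxmin =>
    (hVconv.add_convexOn (convexOn_Wcp n α)).eq_of_isMinOn hxmin hmin hx hx₀⟩
  by_contra! hle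
  obtain ⟨i, -, hi⟩ := exists_mul_sum_le_mul_sum Finset.univ_nonempty α x₀
  have hline : HasDerivAt (fun t : ℝ => x₀ + t • (Pi.single i 1 : Fin n → ℝ)) (Pi.single i 1) 0 := by
    simpa using ((hasDerivAt_id (0 : ℝ)).smul_const (Pi.single i 1 : Fin n → ℝ)).const_add x₀
  have hVd : HasDerivAt (fun t : ℝ => V (x₀ + t • Pi.single i 1))
      (fderiv ℝ V x₀ (Pi.single i 1)) 0 :=
    HasFDerivAt.comp_hasDerivAt (f := fun t : ℝ => x₀ + t • (Pi.single i 1 : Fin n → ℝ)) 0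
      (by simpa using (hdiff x₀ hx₀).hasFDerivAt) hline
  have hlocal : IsLocalMin
      (fun t : ℝ => V (x₀ + t • Pi.single i 1) + Wcp n α (x₀ + t • Pi.single i 1)) 0 := by
    have hmem : ∀ᶠ t in nhds (0 : ℝ), x₀ + t • (Pi.single i 1 : Fin n → ℝ) ∈ Pcp n :=
      hline.continuousAt.eventually_mem ((isOpen_Pcp n).mem_nhds (by simpa using hx₀))
    filter_upwards [hmem] with t ht
    simpa using hmin ht
  have hcrit := hlocal.hasDerivAt_eq_zero (hVd.add (hasDerivAt_Wcp_add_single α hx₀ i))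
  have hWle : (∑ j, α j) ^ 2 / (1 - ∑ j, x₀ j) ^ 2 ≤ α i ^ 2 / x₀ i ^ 2 := by
    have hA : 0 ≤ ∑ j, α j := Finset.sum_nonneg fun j _ => (hα j).le
    rw [← div_pow, ← div_pow]
    refine pow_le_pow_left₀ (div_nonneg hA (sub_pos.2 hx₀.2).le) ?_ 2
    rw [div_le_div_iff₀ (sub_pos.2 hx₀.2) (hx₀.1 i)]
    exact hi.trans (mul_le_mul_of_nonneg_left (by linarith) (hα i).le)
  have hT : 0 ≤ 1 / 2 - ∑ j, x₀ j := sub_nonneg.2 hle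
  have hsum : ∑ j, (x₀ + (1 / 2 - ∑ j, x₀ j) • (Pi.single i 1 : Fin n → ℝ)) j = 1 / 2 := by
    simp [Finset.sum_add_distrib, ← Finset.mul_sum]
  have hy : x₀ + (1 / 2 - ∑ j, x₀ j) • (Pi.single i 1 : Fin n → ℝ) ∈ Pcp n := by
    refine ⟨fun j => add_pos_of_pos_of_nonneg (hx₀.1 j) (mul_nonneg hT ?_), by
      rw [hsum]; norm_num⟩
    exact (Pi.single_nonneg.2 zero_le_one : (0 : Fin n → ℝ) ≤ Pi.single i 1) j
  have hmono := fderiv_apply_le_of_convexOn hVconv.convexOn hT hx₀ hy (hdiff _ hx₀) (hdiff _ hy)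
  have hneg := hVgrad _ hy hsum i
  linarith
end

section
/- Fix α = (α₁,α₂) with α₁,α₂ > 0. If x ∈ 𝒫 is a critical point of the function x ↦ W(α,x) (i.e. ∂W/∂x₁(α,x) = ∂W/∂x₂(α,x) = 0), then x₂ < 1/2 and x₁ + n x₂* = n + 1 − x₁ − n x₂; equivalently, x lies on the curve x₁ = (n+1)/2 − (n/2)(x₂ + √n · x₂(1−x₂)/√(1−2x₂)). -/
/-- The kinetic term of the canonical metric on the Hirzebruch surface `ℋₙ`:
`W(α,x) = (1/2)[α₁²/x₁ + α₂²/x₂ + α₂²/(1−x₂) + (α₁+nα₂)²/(n+1−x₁−nx₂)]`. -/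
noncomputable def Wh (n : ℕ) (a1 a2 x1 x2 : ℝ) : ℝ :=
  (1 / 2) * (a1 ^ 2 / x1 + a2 ^ 2 / x2 + a2 ^ 2 / (1 - x2)
    + (a1 + n * a2) ^ 2 / (n + 1 - x1 - n * x2))

/-- The interior of the moment polytope of the Hirzebruch surface `ℋₙ`. -/
def Ph (n : ℕ) : Set (ℝ × ℝ) :=
  {x | 0 < x.1 ∧ 0 < x.2 ∧ x.2 < 1 ∧ 0 < n + 1 - x.1 - n * x.2}

/-- The auxiliary quantity `x₂* = √n · x₂(1−x₂)/√(1−2x₂)`. -/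
noncomputable def x2star (n : ℕ) (x2 : ℝ) : ℝ :=
  Real.sqrt n * (x2 * (1 - x2)) / Real.sqrt (1 - 2 * x2)

/-- The derivative of `x₁ ↦ W(α,x)`. -/
lemma hasDerivAt_Wh_fst (n : ℕ) (a1 a2 x1 x2 : ℝ) (h1 : x1 ≠ 0)
    (hD : n + 1 - x1 - n * x2 ≠ 0) :
    HasDerivAt (fun t => Wh n a1 a2 t x2)
      ((1 / 2) * (((a1 + n * a2) / (n + 1 - x1 - n * x2)) ^ 2 - (a1 / x1) ^ 2)) x1 := by
  unfold Wh
  have hd : HasDerivAt (fun t : ℝ => n + 1 - t - n * x2) (-1) x1 :=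
    ((hasDerivAt_id x1).const_sub _).sub_const _
  have h := (((((hasDerivAt_const x1 (a1 ^ 2)).fun_div (hasDerivAt_id x1) h1).add_const
    (a2 ^ 2 / x2)).add_const (a2 ^ 2 / (1 - x2))).fun_add
    ((hasDerivAt_const x1 ((a1 + n * a2) ^ 2)).fun_div hd hD)).const_mul (1 / 2)
  refine h.congr_deriv ?_
  simp only [id, div_pow]
  ring

/-- The derivative of `x₂ ↦ W(α,x)`. -/
lemma hasDerivAt_Wh_snd (n : ℕ) (a1 a2 x1 x2 : ℝ) (h2 : x2 ≠ 0) (h3 : 1 - x2 ≠ 0)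
    (hD : n + 1 - x1 - n * x2 ≠ 0) :
    HasDerivAt (fun t => Wh n a1 a2 x1 t)
      ((1 / 2) * (n * ((a1 + n * a2) / (n + 1 - x1 - n * x2)) ^ 2 + (a2 / (1 - x2)) ^ 2
        - (a2 / x2) ^ 2)) x2 := by
  unfold Wh
  have hd : HasDerivAt (fun t : ℝ => n + 1 - x1 - n * t) (-(n * 1)) x2 :=
    ((hasDerivAt_id x2).const_mul _).const_sub _
  have hs : HasDerivAt (fun t : ℝ => 1 - t) (-1) x2 := (hasDerivAt_id x2).const_sub _
  have h := (((((hasDerivAt_const x2 (a2 ^ 2)).fun_div (hasDerivAt_id x2) h2).const_add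
    (a1 ^ 2 / x1)).fun_add ((hasDerivAt_const x2 (a2 ^ 2)).fun_div hs h3)).fun_add
    ((hasDerivAt_const x2 ((a1 + n * a2) ^ 2)).fun_div hd hD)).const_mul (1 / 2)
  refine h.congr_deriv ?_
  simp only [id, div_pow]
  ring

/-- For fixed `α = (α₁,α₂)` with `α₁, α₂ > 0`, every critical point of
`x ↦ W(α,x)` in `𝒫` satisfies `x₂ < 1/2` and `x₁ + n x₂* = n + 1 − x₁ − n x₂`,
i.e. it lies on the curve `x₁ = (n+1)/2 − (n/2)(x₂ + √n·x₂(1−x₂)/√(1−2x₂))`. -/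
theorem stmt_14 (n : ℕ) (hn : 1 ≤ n) (a1 a2 : ℝ) (ha1 : 0 < a1) (ha2 : 0 < a2)
    (x : ℝ × ℝ) (hx : x ∈ Ph n)
    (hc1 : deriv (fun t => Wh n a1 a2 t x.2) x.1 = 0)
    (hc2 : deriv (fun t => Wh n a1 a2 x.1 t) x.2 = 0) :
    x.2 < 1 / 2 ∧ x.1 + n * x2star n x.2 = n + 1 - x.1 - n * x.2 := by
  obtain ⟨x1, x2⟩ := x
  obtain ⟨h1, h2, h3, hD⟩ := hx
  dsimp only at *
  rw [← sub_pos] at h3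
  rw [(hasDerivAt_Wh_fst n a1 a2 x1 x2 h1.ne' hD.ne').deriv] at hc1
  rw [(hasDerivAt_Wh_snd n a1 a2 x1 x2 h2.ne' h3.ne' hD.ne').deriv] at hc2
  have hn0 : (0 : ℝ) < n := by exact_mod_cast hn
  obtain ⟨k, hk⟩ : ∃ k, k = a1 / x1 := ⟨_, rfl⟩
  have hk0 : 0 < k := hk ▸ div_pos ha1 h1
  have hk' : (a1 + n * a2) / (n + 1 - x1 - n * x2) = k := by
    rw [← sq_eq_sq₀ (by positivity) hk0.le, hk]
    linarith
  rw [hk'] at hc2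
  rw [eq_div_iff h1.ne'] at hk
  rw [div_eq_iff hD.ne'] at hk'
  have key : a2 ^ 2 * (1 - 2 * x2) = n * (k * (x2 * (1 - x2))) ^ 2 := by
    have h : (n : ℝ) * k ^ 2 = (a2 / x2) ^ 2 - (a2 / (1 - x2)) ^ 2 := by linarith
    rw [mul_pow, ← mul_assoc, h]
    field_simp
    ring
  have hpos : 0 < 1 - 2 * x2 := by
    have : 0 < a2 ^ 2 * (1 - 2 * x2) := key ▸ by positivity
    exact pos_of_mul_pos_right this (by positivity)
  refine ⟨by linarith, ?_⟩
  have hstar : a2 = k * x2star n x2 := by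
    unfold x2star
    rw [← mul_div_assoc, eq_div_iff (Real.sqrt_pos.2 hpos).ne',
      ← sq_eq_sq₀ (by positivity) (by positivity), mul_pow, Real.sq_sqrt hpos.le, key]
    simp only [mul_pow, Real.sq_sqrt hn0.le]
    ring
  apply mul_left_cancel₀ hk0.ne'
  linear_combination hk' + hk - n * hstar
end

section
/- For every x ∈ ℛ and every α = (α₁,α₂) with α₁,α₂ > 0, the determinant of the 2 × 2 mixed Hessian matrix [∂²W/∂xᵢ∂αⱼ(α,x)]_{1 ≤ i,j ≤ 2} is strictly negative; in particular this matrix is non-degenerate on ℛ × (ℝ₊)². -/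
/-- The subregion `ℛ = {x ∈ 𝒫 : 0 < x₂ < 1/2, x₁ + n x₂* > n+1−x₁−n x₂}`. -/
def Rh (n : ℕ) : Set (ℝ × ℝ) :=
  {x ∈ Ph n | x.2 < 1 / 2 ∧ (n : ℝ) + 1 - x.1 - n * x.2 < x.1 + n * x2star n x.2}

theorem deriv_Wh_fst (n : ℕ) (a1 a2 x1 x2 : ℝ) :
    deriv (fun a => Wh n a a2 x1 x2) a1
      = a1 / x1 + (a1 + n * a2) / (n + 1 - x1 - n * x2) := by
  have h : HasDerivAt (fun a => Wh n a a2 x1 x2) _ a1 :=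
    (((((hasDerivAt_id a1).pow 2).div_const x1).add_const (a2 ^ 2 / x2)
      |>.add_const (a2 ^ 2 / (1 - x2))).add
      ((((hasDerivAt_id a1).add_const (n * a2)).pow 2).div_const
        (n + 1 - x1 - n * x2))).const_mul (1 / 2)
  rw [h.deriv]
  simp only [id, Nat.cast_ofNat]
  ring

theorem deriv_Wh_snd (n : ℕ) (a1 a2 x1 x2 : ℝ) :
    deriv (fun a => Wh n a1 a x1 x2) a2
      = a2 / x2 + a2 / (1 - x2) + n * (a1 + n * a2) / (n + 1 - x1 - n * x2) := by
  have h : HasDerivAt (fun a => Wh n a1 a x1 x2) _ a2 :=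
    (((((hasDerivAt_id a2).pow 2).div_const x2).const_add (a1 ^ 2 / x1)).add
      (((hasDerivAt_id a2).pow 2).div_const (1 - x2)) |>.add
      (((((hasDerivAt_id a2).const_mul (n : ℝ)).const_add a1).pow 2).div_const
        (n + 1 - x1 - n * x2))).const_mul (1 / 2)
  rw [h.deriv]
  simp only [id, Nat.cast_ofNat]
  ring

theorem hasDerivAt_const_div {f : ℝ → ℝ} {f' s : ℝ} (c : ℝ) (hf : HasDerivAt f f' s)
    (h : f s ≠ 0) : HasDerivAt (fun t => c / f t) (-(c * f') / f s ^ 2) s := by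
  simpa using (hasDerivAt_const s c).fun_div hf h

/-- A weighted Cauchy–Schwarz inequality. -/
theorem mul_sq_lt_of_lt_add {n a b x z l : ℝ} (hn : 0 ≤ n) (ha : 0 < a) (hb : 0 < b)
    (hl : 0 < l) (h : l < x + n * z) :
    a * b * l ^ 2 < (a + n * b) * (a * n * z ^ 2 + b * x ^ 2) := by
  have h1 : a * b * l ^ 2 < a * b * (x + n * z) ^ 2 := by gcongr
  nlinarith [mul_nonneg hn (sq_nonneg (a * z - b * x))]

theorem x2star_sq (n : ℕ) {y : ℝ} (hy : y < 1 / 2) :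
    x2star n y ^ 2 * (1 - 2 * y) = n * (y * (1 - y)) ^ 2 := by
  have h : 0 < 1 - 2 * y := by linarith
  rw [x2star, div_pow, mul_pow, Real.sq_sqrt n.cast_nonneg, Real.sq_sqrt h.le,
    div_mul_cancel₀ _ h.ne']

/-- For every `x ∈ ℛ` and `α₁, α₂ > 0`, the determinant of the `2 × 2` mixed
Hessian `[∂²W/∂xᵢ∂αⱼ(α,x)]` of the Hirzebruch kinetic term is strictly negative;
in particular this matrix is non-degenerate on `ℛ × ℝ₊²`. -/
theorem stmt_16 (n : ℕ) (hn : 1 ≤ n) (x : ℝ × ℝ) (hx : x ∈ Rh n)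
    (a1 a2 : ℝ) (ha1 : 0 < a1) (ha2 : 0 < a2) :
    (deriv (fun s => deriv (fun a => Wh n a a2 s x.2) a1) x.1)
        * (deriv (fun s => deriv (fun a => Wh n a1 a x.1 s) a2) x.2)
      - (deriv (fun s => deriv (fun a => Wh n a1 a s x.2) a2) x.1)
        * (deriv (fun s => deriv (fun a => Wh n a a2 x.1 s) a1) x.2) < 0 := by
  obtain ⟨x1, y⟩ := x
  obtain ⟨⟨hx1, hy, hy1, hL⟩, hy2, hR⟩ := hx
  simp only at hx1 hy hy1 hL hy2 hR ⊢
  simp only [deriv_Wh_fst, deriv_Wh_snd]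
  have hn' : (0 : ℝ) < n := by exact_mod_cast hn
  have hy1' : 0 < 1 - y := by linarith
  have hz := x2star_sq n hy2
  have key := mul_sq_lt_of_lt_add hn'.le ha1 ha2 hL hR
  have hL1 : HasDerivAt (fun s : ℝ => n + 1 - s - n * y) (-1) x1 :=
    ((hasDerivAt_id x1).const_sub ((n : ℝ) + 1)).sub_const (n * y)
  have hL2 : HasDerivAt (fun s : ℝ => n + 1 - x1 - n * s) (-(n * 1)) y :=
    ((hasDerivAt_id y).const_mul (n : ℝ)).const_sub ((n : ℝ) + 1 - x1)
  have hid : HasDerivAt (fun s : ℝ => 1 - s) (-1) y := (hasDerivAt_id y).const_sub 1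
  have h11 := (hasDerivAt_const_div a1 (hasDerivAt_id' x1) hx1.ne').fun_add
    (hasDerivAt_const_div (a1 + n * a2) hL1 hL.ne')
  have h12 := (hasDerivAt_const_div (n * (a1 + n * a2)) hL1 hL.ne').const_add
    (a2 / y + a2 / (1 - y))
  have h22 := ((hasDerivAt_const_div a2 (hasDerivAt_id' y) hy.ne').fun_add
    (hasDerivAt_const_div a2 hid hy1'.ne')).fun_add
    (hasDerivAt_const_div (n * (a1 + n * a2)) hL2 hL.ne')
  have h21 := (hasDerivAt_const_div (a1 + n * a2) hL2 hL.ne').const_add (a1 / x1)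
  rw [h11.deriv, h12.deriv, h22.deriv, h21.deriv]
  set L := (n : ℝ) + 1 - x1 - n * y
  set z := x2star n y
  have hq : 0 < 1 - 2 * y := by linarith
  have hdet : a1 * a2 * L ^ 2 * (1 - 2 * y)
      < (a1 + n * a2) * (a1 * n ^ 2 * (y * (1 - y)) ^ 2 + a2 * x1 ^ 2 * (1 - 2 * y)) := by
    calc _ < _ := mul_lt_mul_of_pos_right key hq
      _ = _ := by linear_combination (a1 + n * a2) * a1 * n * hz
  have hdiv := div_neg_of_neg_of_pos (sub_neg.2 hdet)
    (show 0 < x1 ^ 2 * L ^ 2 * (y * (1 - y)) ^ 2 by positivity)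
  refine lt_of_eq_of_lt ?_ hdiv
  have hL0 := hL.ne'
  clear_value L
  field_simp
  ring
end

section
/- Let ℝ₊ⁿ = {y ∈ ℝⁿ : yᵢ > 0 for all i}, let α ∈ ℝⁿ have all αᵢ ≠ 0, and let V : ℝ₊ⁿ → ℝ be a convex continuous function that is proper (preimages of compact sets are compact) and bounded below. Then the function y ↦ V(y) + (1/2) Σᵢ αᵢ²/yᵢ attains a unique global minimum on ℝ₊ⁿ. -/
theorem convex_positiveOrthant {ι : Type*} : Convex ℝ {y : ι → ℝ | ∀ i, 0 < y i} := by
  intro x hx y hy a b ha hb hab i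
  exact convex_Ioi (0 : ℝ) (hx i) (hy i) ha hb hab

/-- The weighted sum of reciprocals with positive weights is strictly convex on the open positive
orthant. -/
theorem strictConvexOn_sum_div {ι : Type*} [Fintype ι] {w : ι → ℝ} (hw : ∀ i, 0 < w i) :
    StrictConvexOn ℝ {y : ι → ℝ | ∀ i, 0 < y i} (fun y => ∑ i, w i / y i) := by
  have hinv : StrictConvexOn ℝ (Set.Ioi (0 : ℝ)) fun t : ℝ => t⁻¹ := by
    simpa using strictConvexOn_zpow (m := -1) (by norm_num) (by norm_num)
  refine ⟨convex_positiveOrthant, fun x hx y hy hxy a b ha hb hab => ?_⟩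
  obtain ⟨j, hj⟩ := Function.ne_iff.mp hxy
  simp only [smul_eq_mul, Finset.mul_sum, ← Finset.sum_add_distrib, Pi.add_apply, Pi.smul_apply]
  refine Finset.sum_lt_sum (fun i _ => ?_) ⟨j, Finset.mem_univ j, ?_⟩
  · have h := hinv.convexOn.2 (hx i) (hy i) ha.le hb.le hab
    simp only [smul_eq_mul] at h
    simp only [div_eq_mul_inv]
    linarith [mul_le_mul_of_nonneg_left h (hw i).le]
  · have h := hinv.2 (hx j) (hy j) hj ha hb hab
    simp only [smul_eq_mul] at h
    simp only [div_eq_mul_inv]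
    linarith [mul_lt_mul_of_pos_left h (hw j)]

/-- Let `V` be a convex continuous function on the open positive orthant `ℝ₊ⁿ` that
is proper (preimages of compacts are compact) and bounded below, and let `α` have
all `αᵢ ≠ 0`.  Then `y ↦ V(y) + (1/2) Σᵢ αᵢ²/yᵢ` attains a unique global minimum
on `ℝ₊ⁿ`. -/
theorem stmt_19 {n : ℕ} (hn : 0 < n) (α : Fin n → ℝ) (hα : ∀ i, α i ≠ 0)
    (V : (Fin n → ℝ) → ℝ)
    (hVconv : ConvexOn ℝ {y : Fin n → ℝ | ∀ i, 0 < y i} V)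
    (hVcont : ContinuousOn V {y : Fin n → ℝ | ∀ i, 0 < y i})
    (hVproper : ∀ K : Set ℝ, IsCompact K →
      IsCompact {y : Fin n → ℝ | (∀ i, 0 < y i) ∧ V y ∈ K})
    (hVbdd : ∃ c : ℝ, ∀ y : Fin n → ℝ, (∀ i, 0 < y i) → c ≤ V y) :
    ∃! y₀ : Fin n → ℝ, (∀ i, 0 < y₀ i) ∧
      ∀ y : Fin n → ℝ, (∀ i, 0 < y i) →
        V y₀ + (1 / 2) * ∑ i, (α i) ^ 2 / y₀ i ≤ V y + (1 / 2) * ∑ i, (α i) ^ 2 / y i := by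
  obtain ⟨c, hc⟩ := hVbdd
  set P : Set (Fin n → ℝ) := {y | ∀ i, 0 < y i}
  set B : (Fin n → ℝ) → ℝ := fun y => (1 / 2) * ∑ i, (α i) ^ 2 / y i with hB
  have hBnonneg : ∀ y ∈ P, 0 ≤ B y := fun y hy =>
    mul_nonneg (by norm_num) (Finset.sum_nonneg fun i _ => div_nonneg (sq_nonneg _) (hy i).le)
  have hBconv : StrictConvexOn ℝ P B := by
    have h := strictConvexOn_sum_div (w := fun i => (1 / 2) * (α i) ^ 2)
      fun i => mul_pos (by norm_num) (sq_pos_of_ne_zero (hα i))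
    simpa only [hB, Finset.mul_sum, mul_div_assoc] using h
  have hBcont : ContinuousOn B P :=
    continuousOn_const.mul <| continuousOn_finsetSum _ fun i _ =>
      continuousOn_const.div (continuous_apply i).continuousOn fun y hy => (hy i).ne'
  have hone : (1 : Fin n → ℝ) ∈ P := fun _ => one_pos
  set K : Set (Fin n → ℝ) := {y | (∀ i, 0 < y i) ∧ V y ∈ Set.Icc c (V 1 + B 1)}
  have hKP : K ⊆ P := fun y hy => hy.1
  have hKone : (1 : Fin n → ℝ) ∈ K := ⟨hone, hc 1 hone, by linarith [hBnonneg 1 hone]⟩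
  obtain ⟨y₀, hy₀, hmin⟩ := (hVproper _ isCompact_Icc).exists_isMinOn ⟨1, hKone⟩
    ((hVcont.add hBcont).mono hKP)
  have hconv : StrictConvexOn ℝ P (V + B) := hVconv.add_strictConvexOn hBconv
  have hglobal : IsMinOn (V + B) P y₀ := isMinOn_iff.mpr fun y hy => by
    by_cases hyM : V y ≤ V 1 + B 1
    · exact hmin ⟨hy, hc y hy, hyM⟩
    · have h : V y₀ + B y₀ ≤ V 1 + B 1 := hmin hKone
      change V y₀ + B y₀ ≤ V y + B y
      linarith [hBnonneg y hy]
  exact ⟨y₀, ⟨hKP hy₀, isMinOn_iff.mp hglobal⟩, fun z hz =>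
    hconv.eq_of_isMinOn (isMinOn_iff.mpr hz.2) hglobal hz.1 (hKP hy₀)⟩
end
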